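/- arXiv:1509.05822 — 2 statements merged into one kernel-verified Lean document; each statement's English description precedes it below -/
import Mathlib

section
/- Let d ≥ 3 be an integer, let a > -((d-2)/2)² be real, set β := √(1 + 4a/(d-2)²), and let W_a(x) := (d(d-2)β²)^{(d-2)/4} · (|x|^{β-1}/(1+|x|^{2β}))^{(d-2)/2}. For α ∈ ℂ with α ≠ 0 and λ > 0, let f(x) := α W_a(λx). Then Q_a(f) and ∫_{ℝ^d} |f|^{2d/(d-2)} dx are finite and equality holds in the Sobolev inequality: (∫_{ℝ^d} |f|^{2d/(d-2)} dx)^{(d-2)/(2d)} · Q_a(W_a)^{1/2} = (∫_{ℝ^d} W_a^{2d/(d-2)} dx)^{(d-2)/(2d)} · Q_a(f)^{1/2}. In particular, the rescaled ground states αW_a(λ·) are optimizers for the Sobolev embedding with inverse-square potential. -/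
open MeasureTheory

lemma integrableOn_Ioi_profile_pow {β : ℝ} (hβ : 0 < β) {m : ℕ} (hm : m ≠ 0) :
    IntegrableOn (fun r : ℝ => (r ^ β / (1 + r ^ (2 * β))) ^ m / r) (Set.Ioi 0) := by
  have hmβ : 0 < (m : ℝ) * β := by positivity
  have hmeas : Measurable (fun r : ℝ => (r ^ β / (1 + r ^ (2 * β))) ^ m / r) := by fun_prop
  have hsq : ∀ r : ℝ, 0 < r → r ^ (2 * β) = (r ^ β) ^ 2 := fun r hr => by
    rw [mul_comm, Real.rpow_mul hr.le, Real.rpow_two]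
  have hnonneg : ∀ r : ℝ, 0 < r → 0 ≤ (r ^ β / (1 + r ^ (2 * β))) ^ m / r :=
    fun r hr => by positivity
  rw [← Set.Ioc_union_Ioi_eq_Ioi zero_le_one]
  refine IntegrableOn.union ?_ ?_
  · have hint : IntegrableOn (fun r : ℝ => r ^ ((m : ℝ) * β - 1)) (Set.Ioc 0 1) := by
      rw [← intervalIntegrable_iff_integrableOn_Ioc_of_le zero_le_one]
      exact intervalIntegral.intervalIntegrable_rpow' (by linarith)
    refine Integrable.mono' hint hmeas.aestronglyMeasurable ?_
    refine (ae_restrict_iff' measurableSet_Ioc).2 (.of_forall fun r hr => ?_)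
    have hr0 : 0 < r := hr.1
    have hu : 0 < r ^ β := Real.rpow_pos_of_pos hr0 β
    rw [Real.norm_of_nonneg (hnonneg r hr0), hsq r hr0, Real.rpow_sub_one hr0.ne',
      mul_comm (m : ℝ), Real.rpow_mul hr0.le, Real.rpow_natCast]
    gcongr
    exact div_le_self hu.le (by nlinarith)
  · have hint : IntegrableOn (fun r : ℝ => r ^ (-((m : ℝ) * β) - 1)) (Set.Ioi 1) :=
      integrableOn_Ioi_rpow_of_lt (by linarith) one_pos
    refine Integrable.mono' hint hmeas.aestronglyMeasurable ?_
    refine (ae_restrict_iff' measurableSet_Ioi).2 (.of_forall fun r hr => ?_)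
    have hr0 : 0 < r := one_pos.trans hr
    have hu : 0 < r ^ β := Real.rpow_pos_of_pos hr0 β
    rw [Real.norm_of_nonneg (hnonneg r hr0), hsq r hr0, Real.rpow_sub_one hr0.ne',
      mul_comm (m : ℝ), Real.rpow_neg hr0.le, Real.rpow_mul hr0.le, Real.rpow_natCast, ← inv_pow]
    gcongr
    rw [div_le_iff₀ (by positivity)]
    field_simp
    nlinarith

lemma hasDerivAt_profile_rpow (β s : ℝ) {r : ℝ} (hr : 0 < r) :
    HasDerivAt (fun r : ℝ => (r ^ (β - 1) / (1 + r ^ (2 * β))) ^ s)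
      ((r ^ (β - 1) / (1 + r ^ (2 * β))) ^ s *
        (s * (β - 1 - 2 * β * (r ^ (2 * β) / (1 + r ^ (2 * β)))) / r)) r := by
  have hv : 0 < r ^ (2 * β) := Real.rpow_pos_of_pos hr _
  have hw : 0 < r ^ (β - 1) := Real.rpow_pos_of_pos hr _
  have hq : r ^ (β - 1) / (1 + r ^ (2 * β)) ≠ 0 := by positivity
  have h1 := Real.hasDerivAt_rpow_const (p := β - 1) (.inl hr.ne')
  have h2 := (Real.hasDerivAt_rpow_const (p := 2 * β) (.inl hr.ne')).const_add 1
  refine ((h1.div h2 (by positivity)).rpow_const (p := s) (.inl hq)).congr_deriv ?_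
  change _ * s * (r ^ (β - 1) / (1 + r ^ (2 * β))) ^ (s - 1) = _
  rw [Real.rpow_sub_one hq s, Real.rpow_sub_one hr.ne' (β - 1), Real.rpow_sub_one hr.ne' (2 * β)]
  field_simp

lemma hasFDerivAt_comp_norm {E : Type*} [NormedAddCommGroup E] [InnerProductSpace ℝ E]
    {g : ℝ → ℝ} {g' : ℝ} {x : E} (hx : x ≠ 0) (hg : HasDerivAt g g' ‖x‖) :
    HasFDerivAt (fun y => g ‖y‖) ((g' / ‖x‖) • innerSL ℝ x) x := by
  have hn : ‖x‖ ≠ 0 := norm_ne_zero_iff.2 hx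
  have h := (hasStrictFDerivAt_norm_sq x).hasFDerivAt.sqrt (by positivity)
  simp only [Real.sqrt_sq (norm_nonneg _)] at h
  refine (hg.comp_hasFDerivAt x h).congr_fderiv ?_
  ext v
  simp
  field_simp

lemma sum_sq_smul_innerSL_single {ι : Type*} [Fintype ι] [DecidableEq ι] (c : ℝ)
    (x : EuclideanSpace ℝ ι) :
    ∑ i, ((c • innerSL ℝ x) (EuclideanSpace.single i 1)) ^ 2 = c ^ 2 * ‖x‖ ^ 2 := by
  simp [EuclideanSpace.real_norm_sq_eq, EuclideanSpace.inner_single_right, mul_pow,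
    Finset.mul_sum]

lemma integrable_profile_pow {E : Type*} [NormedAddCommGroup E] [NormedSpace ℝ E]
    [FiniteDimensional ℝ E] [MeasurableSpace E] [BorelSpace E] [Nontrivial E]
    (μ : Measure E) [μ.IsAddHaarMeasure] {β : ℝ} (hβ : 0 < β) {m j : ℕ} (hm : m ≠ 0)
    (hmj : m + j = Module.finrank ℝ E) :
    Integrable (fun x : E => (‖x‖ ^ (β - 1) / (1 + ‖x‖ ^ (2 * β))) ^ m / ‖x‖ ^ j) μ := by
  rw [integrable_fun_norm_addHaar μ
    (f := fun r : ℝ => (r ^ (β - 1) / (1 + r ^ (2 * β))) ^ m / r ^ j)]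
  refine (integrableOn_Ioi_profile_pow hβ hm).congr_fun (fun r hr => ?_) measurableSet_Ioi
  have hr0 : 0 < r := hr
  obtain ⟨n, rfl⟩ := Nat.exists_eq_succ_of_ne_zero hm
  have : Module.finrank ℝ E - 1 = n + j := by omega
  simp only [this, smul_eq_mul, Real.rpow_sub_one hr0.ne', div_pow, Nat.succ_eq_add_one]
  field_simp
  ring

/-- The rescaled ground states `f(x) = α W_a(λx)` have finite
`Q_a(f)` and `∫|f|^{2d/(d-2)}`, and they attain equality in the Sobolev
inequality with inverse-square potential. -/
theorem ground_state_rescalings_are_optimizers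
    (d : ℕ) (hd : 3 ≤ d) (a : ℝ) (ha : -(((d : ℝ) - 2) / 2) ^ 2 < a)
    (β : ℝ) (hβ : β = Real.sqrt (1 + 4 * a / ((d : ℝ) - 2) ^ 2))
    (W : EuclideanSpace ℝ (Fin d) → ℝ)
    (hW : ∀ x, W x = ((d : ℝ) * ((d : ℝ) - 2) * β ^ 2) ^ (((d : ℝ) - 2) / 4) *
        (‖x‖ ^ (β - 1) / (1 + ‖x‖ ^ (2 * β))) ^ (((d : ℝ) - 2) / 2))
    (α : ℂ) (hα : α ≠ 0) (lam : ℝ) (hlam : 0 < lam)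
    (f : EuclideanSpace ℝ (Fin d) → ℂ)
    (hf : ∀ x, f x = α * (W (lam • x) : ℝ)) :
    Integrable (fun x : EuclideanSpace ℝ (Fin d) =>
        (∑ i, ‖fderiv ℝ f x (EuclideanSpace.single i 1)‖ ^ 2)
          + a / ‖x‖ ^ 2 * ‖f x‖ ^ 2)
    ∧ Integrable (fun x : EuclideanSpace ℝ (Fin d) =>
        ‖f x‖ ^ (2 * (d : ℝ) / ((d : ℝ) - 2)))
    ∧ (∫ x : EuclideanSpace ℝ (Fin d), ‖f x‖ ^ (2 * (d : ℝ) / ((d : ℝ) - 2)))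
          ^ (((d : ℝ) - 2) / (2 * (d : ℝ)))
        * Real.sqrt (∫ x : EuclideanSpace ℝ (Fin d),
            ((∑ i, (fderiv ℝ W x (EuclideanSpace.single i 1)) ^ 2)
              + a / ‖x‖ ^ 2 * (W x) ^ 2))
      = (∫ x : EuclideanSpace ℝ (Fin d), W x ^ (2 * (d : ℝ) / ((d : ℝ) - 2)))
          ^ (((d : ℝ) - 2) / (2 * (d : ℝ)))
        * Real.sqrt (∫ x : EuclideanSpace ℝ (Fin d),
            ((∑ i, ‖fderiv ℝ f x (EuclideanSpace.single i 1)‖ ^ 2)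
              + a / ‖x‖ ^ 2 * ‖f x‖ ^ 2)) := by
  obtain ⟨k, rfl⟩ : ∃ k, d = k + 2 := ⟨d - 2, by omega⟩
  have hk : k ≠ 0 := by omega
  have hk0 : (0 : ℝ) < k := by positivity
  have hd2 : ((k + 2 : ℕ) : ℝ) - 2 = k := by push_cast; ring
  rw [hd2] at ha hβ ⊢
  simp only [hd2] at hW
  have hβ0 : 0 < β := by
    rw [hβ, Real.sqrt_pos]
    field_simp
    nlinarith
  set c : ℝ := (((k + 2 : ℕ) : ℝ) * k * β ^ 2) ^ ((k : ℝ) / 4)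
  set p : ℝ := 2 * ((k + 2 : ℕ) : ℝ) / k with hp
  have hc0 : 0 ≤ c := by positivity
  have hfin : Module.finrank ℝ (EuclideanSpace ℝ (Fin (k + 2))) = k + 2 := by simp
  have hq0 : ∀ x : EuclideanSpace ℝ (Fin (k + 2)), 0 ≤ ‖x‖ ^ (β - 1) / (1 + ‖x‖ ^ (2 * β)) :=
    fun x => by positivity
  have hW0 : ∀ x, 0 ≤ W x := fun x => by rw [hW]; positivity
  have hWp : Integrable fun x => W x ^ p := by
    refine ((integrable_profile_pow (E := EuclideanSpace ℝ (Fin (k + 2))) volume hβ0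
      (m := k + 2) (j := 0) (by omega) (by omega)).const_mul (c ^ p)).congr (.of_forall fun x => ?_)
    have hexp : (k : ℝ) / 2 * p = (k + 2 : ℕ) := by rw [hp]; field_simp
    simp only
    rw [hW, Real.mul_rpow hc0 (Real.rpow_nonneg (hq0 x) _), ← Real.rpow_mul (hq0 x), hexp,
      Real.rpow_natCast, pow_zero, div_one]
  have hWd : ∀ x : EuclideanSpace ℝ (Fin (k + 2)), x ≠ 0 → HasFDerivAt W ((W x *
      ((k : ℝ) / 2 * (β - 1 - 2 * β * (‖x‖ ^ (2 * β) / (1 + ‖x‖ ^ (2 * β)))) / ‖x‖) / ‖x‖) •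
        innerSL ℝ x) x := fun x hx => by
    have h := hasFDerivAt_comp_norm hx
      ((hasDerivAt_profile_rpow β ((k : ℝ) / 2) (norm_pos_iff.2 hx)).const_mul c)
    rw [← mul_assoc, ← hW] at h
    exact h.congr_of_eventuallyEq (.of_forall hW)
  have hne : ∀ᵐ x : EuclideanSpace ℝ (Fin (k + 2)), x ≠ 0 := by simp [ae_iff]
  set QW : EuclideanSpace ℝ (Fin (k + 2)) → ℝ := fun x =>
    (∑ i, (fderiv ℝ W x (EuclideanSpace.single i 1)) ^ 2)
    + a / ‖x‖ ^ 2 * (W x) ^ 2 with hQW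
  have hQWint : Integrable QW := by
    have hbase := (integrable_profile_pow (E := EuclideanSpace ℝ (Fin (k + 2))) volume hβ0
      (m := k) (j := 2) hk (by omega)).const_mul (c ^ 2)
    refine (hbase.bdd_mul (f := fun x : EuclideanSpace ℝ (Fin (k + 2)) => ((k : ℝ) / 2) ^ 2 *
      (β - 1 - 2 * β * (‖x‖ ^ (2 * β) / (1 + ‖x‖ ^ (2 * β)))) ^ 2 + a)
      (c := ((k : ℝ) / 2) ^ 2 * (|β - 1| + 2 * β) ^ 2 + |a|) ?_ ?_).congr ?_
    · exact Measurable.aestronglyMeasurable (by fun_prop)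
    · refine .of_forall fun x => ?_
      have ht0 : 0 ≤ ‖x‖ ^ (2 * β) / (1 + ‖x‖ ^ (2 * β)) := by positivity
      have ht1 : ‖x‖ ^ (2 * β) / (1 + ‖x‖ ^ (2 * β)) ≤ 1 :=
        div_le_one_of_le₀ (by linarith) (by positivity)
      refine (norm_add_le _ _).trans (add_le_add ?_ le_rfl)
      rw [Real.norm_of_nonneg (by positivity), ← sq_abs (β - 1 - _)]
      gcongr
      refine (abs_sub _ _).trans ?_
      gcongr
      rw [abs_of_nonneg (by positivity)]
      exact mul_le_of_le_one_right (by positivity) ht1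
    · filter_upwards [hne] with x hx
      have hn : ‖x‖ ≠ 0 := norm_ne_zero_iff.2 hx
      have hWsq : W x ^ 2 = c ^ 2 * (‖x‖ ^ (β - 1) / (1 + ‖x‖ ^ (2 * β))) ^ k := by
        rw [hW, mul_pow, ← Real.rpow_mul_natCast (hq0 x)]
        norm_num
      simp only [hQW, (hWd x hx).fderiv, sum_sq_smul_innerSL_single]
      rw [div_pow _ ‖x‖, mul_pow (W x), hWsq]
      field_simp
  have hPf : ∀ x, ‖f x‖ ^ p = ‖α‖ ^ p * W (lam • x) ^ p := fun x => by
    rw [hf, norm_mul, Complex.norm_of_nonneg (hW0 _), Real.mul_rpow (norm_nonneg _) (hW0 _)]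
  have hQf : (fun x : EuclideanSpace ℝ (Fin (k + 2)) =>
      (∑ i, ‖fderiv ℝ f x (EuclideanSpace.single i 1)‖ ^ 2) + a / ‖x‖ ^ 2 * ‖f x‖ ^ 2) =ᵐ[volume] fun x => (‖α‖ * lam) ^ 2 * QW (lam • x) := by
    filter_upwards [hne] with x hx
    have hn : ‖x‖ ≠ 0 := norm_ne_zero_iff.2 hx
    have hfd : ∀ v, fderiv ℝ f x v = α * (lam * fderiv ℝ W (lam • x) v : ℝ) := fun v => by
      have hWx := (hWd (lam • x) (smul_ne_zero hlam.ne' hx)).differentiableAt.hasFDerivAt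
      have h := (Complex.ofRealCLM.hasFDerivAt.comp x
        (hWx.comp x ((hasFDerivAt_id x).const_smul lam))).const_mul α
      rw [(h.congr_of_eventuallyEq (.of_forall hf)).fderiv]
      simp
    simp only [hQW, hfd, hf, norm_mul, Complex.norm_real, mul_pow, Real.norm_eq_abs, sq_abs,
      norm_smul, mul_add, Finset.mul_sum]
    congr 1
    · exact Finset.sum_congr rfl fun i _ => by ring
    · field_simp
  have hvol : |(lam ^ (k + 2))⁻¹| = (lam ^ (k + 2))⁻¹ := abs_of_pos (by positivity)
  have hIp : ∫ x : EuclideanSpace ℝ (Fin (k + 2)), ‖f x‖ ^ p =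
      ‖α‖ ^ p * (lam ^ (k + 2))⁻¹ * ∫ x, W x ^ p := by
    simp only [hPf]
    rw [integral_const_mul, Measure.integral_comp_smul volume (fun x => W x ^ p), hfin, hvol,
      smul_eq_mul, mul_assoc]
  refine ⟨((hQWint.comp_smul hlam.ne').const_mul _).congr hQf.symm, ?_, ?_⟩
  · simp only [hPf]
    exact (hWp.comp_smul hlam.ne').const_mul _
  · have hpinv : (k : ℝ) / (2 * ((k + 2 : ℕ) : ℝ)) = p⁻¹ := by rw [hp, inv_div]
    have hp0 : p ≠ 0 := by positivity
    have hscale : (‖α‖ * lam) ^ 2 * (lam ^ (k + 2))⁻¹ =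
        ((‖α‖ ^ p * (lam ^ (k + 2))⁻¹) ^ p⁻¹) ^ 2 := by
      rw [Real.mul_rpow (by positivity) (by positivity), Real.rpow_rpow_inv (norm_nonneg _) hp0,
        Real.inv_rpow (by positivity), ← Real.rpow_natCast lam, ← Real.rpow_mul hlam.le,
        ← hpinv, show ((k + 2 : ℕ) : ℝ) * (k / (2 * ((k + 2 : ℕ) : ℝ))) = k / 2 by field_simp,
        mul_pow _ _⁻¹, inv_pow, ← Real.rpow_mul_natCast hlam.le, Real.rpow_natCast,
        show (k : ℝ) / 2 * (2 : ℕ) = k by push_cast; ring, Real.rpow_natCast]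
      field_simp
      ring
    rw [integral_congr_ae hQf, integral_const_mul, Measure.integral_comp_smul volume QW, hfin,
      hvol, smul_eq_mul, ← mul_assoc, hscale, Real.sqrt_mul (sq_nonneg _),
      Real.sqrt_sq (by positivity), hIp, hpinv,
      Real.mul_rpow (by positivity) (integral_nonneg fun x => Real.rpow_nonneg (hW0 x) _)]
    ring
end

section
/- Let d ≥ 3 be an integer and let a > 0 be real. Let W_0(x) := (d(d-2))^{(d-2)/4} (1+|x|²)^{-(d-2)/2} and C₀ := (∫_{ℝ^d} W_0^{2d/(d-2)} dx)^{(d-2)/(2d)} · (∫_{ℝ^d} |∇W_0|² dx)^{-1/2}. Then the constant C₀ cannot be improved for the Sobolev inequality with inverse-square potential: for every ε > 0 there exists a nonzero f ∈ C_c^∞(ℝ^d \ {0}; ℂ) with (∫_{ℝ^d} |f|^{2d/(d-2)} dx)^{(d-2)/(2d)} > (C₀ - ε) · (∫_{ℝ^d} (|∇f(x)|² + (a/|x|²)|f(x)|²) dx)^{1/2}. -/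
open MeasureTheory

/-- Pointwise bound for the sum of squared partial derivatives by the operator norm. -/
lemma sum_sq_apply_single_le {d : ℕ} (L : EuclideanSpace ℝ (Fin d) →L[ℝ] ℝ) :
    ∑ i, (L (EuclideanSpace.single i 1)) ^ 2 ≤ d * ‖L‖ ^ 2 := by
  have h : ∀ i ∈ Finset.univ, (L (EuclideanSpace.single i 1)) ^ 2 ≤ ‖L‖ ^ 2 := fun i _ => by
    have h1 := L.le_opNorm (EuclideanSpace.single i 1)
    rw [PiLp.norm_single, norm_one, mul_one, Real.norm_eq_abs] at h1
    rw [← sq_abs (L _)]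
    exact pow_le_pow_left₀ (abs_nonneg _) h1 2
  simpa using Finset.sum_le_sum h

lemma hasFDerivAt_one_add_norm_sq_rpow {E : Type*} [NormedAddCommGroup E]
    [InnerProductSpace ℝ E] (c s : ℝ) (x : E) :
    HasFDerivAt (fun x : E => c * (1 + ‖x‖ ^ 2) ^ (-s))
      (c • ((-s * (1 + ‖x‖ ^ 2) ^ (-s - 1)) • ((2 : ℝ) • innerSL ℝ x))) x := by
  have h1 : HasFDerivAt (fun x : E => 1 + ‖x‖ ^ 2) ((2 : ℝ) • innerSL ℝ x) x := by
    simpa [two_smul] using ((hasStrictFDerivAt_norm_sq x).hasFDerivAt).const_add 1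
  exact (h1.rpow_const (Or.inl (by positivity))).const_mul c

/-- The profile `c (1 + ‖x‖²) ^ (-s)` has derivative of size `(1 + ‖x‖²) ^ (-s - 1/2)`. -/
lemma norm_fderiv_one_add_norm_sq_rpow_le {E : Type*} [NormedAddCommGroup E]
    [InnerProductSpace ℝ E] (c s : ℝ) (x : E) :
    ‖fderiv ℝ (fun x : E => c * (1 + ‖x‖ ^ 2) ^ (-s)) x‖ ≤
      2 * |c| * |s| * (1 + ‖x‖ ^ 2) ^ (-s - 1 / 2) := by
  have hp : (0 : ℝ) < 1 + ‖x‖ ^ 2 := by positivity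
  rw [(hasFDerivAt_one_add_norm_sq_rpow c s x).fderiv]
  simp only [norm_smul, Real.norm_eq_abs, abs_mul, abs_neg, innerSL_apply_norm,
    abs_of_pos (Real.rpow_pos_of_pos hp _), abs_two]
  have hx : ‖x‖ ≤ (1 + ‖x‖ ^ 2) ^ (1 / 2 : ℝ) := by
    rw [← Real.sqrt_eq_rpow]
    exact Real.le_sqrt_of_sq_le (by linarith)
  have he : (1 + ‖x‖ ^ 2) ^ (-s - 1 / 2) =
      (1 + ‖x‖ ^ 2) ^ (-s - 1) * (1 + ‖x‖ ^ 2) ^ (1 / 2 : ℝ) := by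
    rw [← Real.rpow_add hp]; congr 1; ring
  rw [he]
  calc |c| * (|s| * (1 + ‖x‖ ^ 2) ^ (-s - 1) * (2 * ‖x‖))
      = 2 * |c| * |s| * ((1 + ‖x‖ ^ 2) ^ (-s - 1) * ‖x‖) := by ring
    _ ≤ _ := by gcongr

/-- Smooth cutoffs at scale `n + 1`, with derivative of size `(1 + ‖x‖²) ^ (-1/2)` uniformly
in `n`. -/
lemma exists_cutoff_seq (E : Type*) [NormedAddCommGroup E] [InnerProductSpace ℝ E]
    [FiniteDimensional ℝ E] :
    ∃ (χ : ℕ → E → ℝ) (K : ℝ), 0 ≤ K ∧ (∀ n, ContDiff ℝ (⊤ : ℕ∞) (χ n)) ∧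
      (∀ n x, 0 ≤ χ n x) ∧ (∀ n x, χ n x ≤ 1) ∧
      (∀ (n : ℕ) x, ‖x‖ < n + 1 → χ n x = 1) ∧
      (∀ (n : ℕ) x, 2 * ((n : ℝ) + 1) ≤ ‖x‖ → χ n x = 0) ∧
      (∀ n x, ‖fderiv ℝ (χ n) x‖ ≤ K * (1 + ‖x‖ ^ 2) ^ (-(1 / 2) : ℝ)) := by
  let φ : ContDiffBump (0 : E) := ⟨1, 2, one_pos, one_lt_two⟩
  have hφ : ContDiff ℝ (⊤ : ℕ∞) φ := φ.contDiff
  obtain ⟨K, hK⟩ := (φ.hasCompactSupport.fderiv (𝕜 := ℝ)).exists_bound_of_continuous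
    (hφ.continuous_fderiv (by simp))
  have hK0 : 0 ≤ K := (norm_nonneg _).trans (hK 0)
  have hr : ∀ n : ℕ, (0 : ℝ) < n + 1 := fun n => by positivity
  have hnorm : ∀ (n : ℕ) (x : E), ‖((n : ℝ) + 1)⁻¹ • x‖ = ‖x‖ / (n + 1) := fun n x => by
    rw [norm_smul, norm_inv, Real.norm_of_nonneg (hr n).le, inv_mul_eq_div]
  have hzero : ∀ (n : ℕ) (x : E), 2 * ((n : ℝ) + 1) ≤ ‖x‖ →
      φ (((n : ℝ) + 1)⁻¹ • x) = 0 := fun n x hx => by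
    apply φ.zero_of_le_dist
    rw [dist_zero_right, hnorm, le_div_iff₀ (hr n)]
    exact hx
  refine ⟨fun n x => φ (((n : ℝ) + 1)⁻¹ • x), 3 * K, by positivity,
    fun n => hφ.comp (contDiff_const_smul _), fun n x => φ.nonneg, fun n x => φ.le_one,
    fun n x hx => ?_, hzero, fun n x => ?_⟩
  · apply φ.one_of_mem_closedBall
    rw [mem_closedBall_zero_iff, hnorm, div_le_iff₀ (hr n)]
    simpa [φ] using hx.le
  · have hp : (0 : ℝ) < 1 + ‖x‖ ^ 2 := by positivity
    rcases le_or_gt ‖x‖ (2 * ((n : ℝ) + 1)) with hx | hx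
    · have hd : HasFDerivAt (fun x : E => φ (((n : ℝ) + 1)⁻¹ • x))
          ((fderiv ℝ φ (((n : ℝ) + 1)⁻¹ • x)).comp
            (((n : ℝ) + 1)⁻¹ • ContinuousLinearMap.id ℝ E)) x :=
        ((hφ.differentiable (by simp)) _).hasFDerivAt.comp x
          ((hasFDerivAt_id x).const_smul (((n : ℝ) + 1)⁻¹))
      rw [hd.fderiv, ContinuousLinearMap.comp_smul, ContinuousLinearMap.comp_id, norm_smul,
        norm_inv, Real.norm_of_nonneg (hr n).le, Real.rpow_neg hp.le, ← Real.sqrt_eq_rpow]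
      have hs : Real.sqrt (1 + ‖x‖ ^ 2) ≤ 3 * ((n : ℝ) + 1) := by
        apply Real.sqrt_le_iff.2 ⟨by positivity, ?_⟩
        nlinarith [norm_nonneg x, hr n, n.cast_nonneg (α := ℝ)]
      have hi : ((n : ℝ) + 1)⁻¹ ≤ 3 * (Real.sqrt (1 + ‖x‖ ^ 2))⁻¹ := by
        rw [inv_eq_one_div, ← div_eq_mul_inv, div_le_div_iff₀ (hr n) (Real.sqrt_pos.2 hp)]
        linarith
      calc ((n : ℝ) + 1)⁻¹ * ‖fderiv ℝ φ (((n : ℝ) + 1)⁻¹ • x)‖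
          ≤ 3 * (Real.sqrt (1 + ‖x‖ ^ 2))⁻¹ * K := by gcongr; exact hK _
        _ = _ := by ring
    · have he : (fun x : E => φ (((n : ℝ) + 1)⁻¹ • x)) =ᶠ[nhds x] fun _ => 0 := by
        filter_upwards [(isOpen_lt continuous_const continuous_norm).mem_nhds hx] with z hz
        exact hzero n z (le_of_lt hz)
      rw [he.fderiv_eq]
      simp only [fderiv_fun_const, Pi.zero_apply, norm_zero]
      positivity

/-- Translating a test function far from the origin makes its inverse-square energy
negligible. -/
lemma exists_translate_of_lt {d : ℕ} [Nontrivial (EuclideanSpace ℝ (Fin d))]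
    {a k p q : ℝ} (ha : 0 < a) (hk : 0 ≤ k)
    {g : EuclideanSpace ℝ (Fin d) → ℝ} (hg : ContDiff ℝ (⊤ : ℕ∞) g) (hne : g ≠ 0) {r : ℝ}
    (hgr : ∀ x, r ≤ ‖x‖ → g x = 0)
    (hlt : k * Real.sqrt (∫ x, ∑ i, (fderiv ℝ g x (EuclideanSpace.single i 1)) ^ 2)
      < (∫ x, |g x| ^ p) ^ q) :
    ∃ f : EuclideanSpace ℝ (Fin d) → ℂ,
        ContDiff ℝ (⊤ : ℕ∞) f ∧ HasCompactSupport f ∧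
        (0 : EuclideanSpace ℝ (Fin d)) ∉ tsupport f ∧ f ≠ 0 ∧
        k * Real.sqrt (∫ x : EuclideanSpace ℝ (Fin d),
              ((∑ i, ‖fderiv ℝ f x (EuclideanSpace.single i 1)‖ ^ 2)
                + a / ‖x‖ ^ 2 * ‖f x‖ ^ 2)) < (∫ x, ‖f x‖ ^ p) ^ q := by
  have hgc : HasCompactSupport g := by
    refine HasCompactSupport.intro (isCompact_closedBall 0 r) fun x hx => hgr x ?_
    rw [mem_closedBall_zero_iff, not_le] at hx
    exact hx.le
  set G : EuclideanSpace ℝ (Fin d) → ℝ :=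
    fun x => ∑ i, (fderiv ℝ g x (EuclideanSpace.single i 1)) ^ 2 with hG
  have hGi : Integrable G := by
    refine integrable_finsetSum _ fun i _ => ?_
    apply Continuous.integrable_of_hasCompactSupport
    · exact ((hg.continuous_fderiv (by simp)).clm_apply continuous_const).pow 2
    · exact (hgc.fderiv_apply (𝕜 := ℝ) _).comp_left (g := fun t : ℝ => t ^ 2) (by simp)
  have hSi : Integrable (fun x => g x ^ 2) := by
    apply Continuous.integrable_of_hasCompactSupport
    · exact hg.continuous.pow 2
    · exact hgc.comp_left (g := fun t : ℝ => t ^ 2) (by simp)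
  obtain ⟨δ, hδ, hδlt⟩ : ∃ δ : ℝ, 0 < δ ∧
      k * Real.sqrt ((∫ x, G x) + δ * ∫ x, g x ^ 2) < (∫ x, |g x| ^ p) ^ q := by
    have hc : Continuous fun δ : ℝ => k * Real.sqrt ((∫ x, G x) + δ * ∫ x, g x ^ 2) := by
      fun_prop
    have h0 := hc.continuousAt.eventually_lt (continuousAt_const (y := (∫ x, |g x| ^ p) ^ q))
      (x₀ := 0) (by simpa using hlt)
    obtain ⟨δ, h1, h2⟩ :=
      ((h0.filter_mono nhdsWithin_le_nhds).and (self_mem_nhdsWithin (s := Set.Ioi 0))).exists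
    exact ⟨δ, h2, h1⟩
  obtain ⟨x₀, hx₀⟩ : ∃ x, g x ≠ 0 := Function.ne_iff.1 hne
  have hr0 : 0 < r := by
    by_contra! h
    exact hx₀ (hgr _ (h.trans (norm_nonneg _)))
  set M : ℝ := Real.sqrt (a / δ) + 1
  have hM0 : 0 < M := by positivity
  have hMδ : a / M ^ 2 ≤ δ := by
    rw [div_le_iff₀ (by positivity), mul_comm, ← div_le_iff₀ hδ]
    have := Real.sq_sqrt (div_pos ha hδ).le
    nlinarith [Real.sqrt_nonneg (a / δ)]
  obtain ⟨y, hy⟩ := NormedSpace.exists_lt_norm ℝ (EuclideanSpace ℝ (Fin d)) (r + M)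
  have hfar : ∀ x, ‖x‖ ≤ M → g (x - y) = 0 := fun x hx => by
    apply hgr
    have := norm_sub_norm_le y x
    rw [norm_sub_rev] at this
    linarith
  have hder : ∀ x v, fderiv ℝ (fun x => (g (x - y) : ℂ)) x v = (fderiv ℝ g (x - y) v : ℝ) := by
    intro x v
    have h1 : HasFDerivAt (fun x => g (x - y)) (fderiv ℝ g (x - y)) x := by
      exact (hasFDerivAt_comp_sub y).2 ((hg.differentiable (by simp)) (x - y)).hasFDerivAt
    exact congrArg (· v) (Complex.ofRealCLM.hasFDerivAt.comp x h1).fderiv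
  refine ⟨fun x => (g (x - y) : ℂ), ?_, ?_, ?_, ?_, ?_⟩
  · exact Complex.ofRealCLM.contDiff.comp (hg.comp (contDiff_id.sub contDiff_const))
  · exact (hgc.comp_homeomorph (Homeomorph.subRight y)).comp_left (g := Complex.ofReal) (by simp)
  · rw [notMem_tsupport_iff_eventuallyEq]
    filter_upwards [Metric.closedBall_mem_nhds 0 hM0] with x hx
    simp [hfar x (by simpa using hx)]
  · intro h
    exact hx₀ (by simpa using congrFun h (x₀ + y))
  · have hp : ∫ x, ‖(g (x - y) : ℂ)‖ ^ p = ∫ x, |g x| ^ p := by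
      simp only [Complex.norm_real, Real.norm_eq_abs]
      exact integral_sub_right_eq_self (fun x => |g x| ^ p) y
    rw [hp]
    refine lt_of_le_of_lt ?_ hδlt
    gcongr
    have hR : (∫ x, G x) + δ * ∫ x, g x ^ 2 = ∫ x, (G (x - y) + δ * g (x - y) ^ 2) := by
      rw [integral_sub_right_eq_self (fun x => G x + δ * g x ^ 2) y,
        integral_add hGi (hSi.const_mul δ), integral_const_mul]
    rw [hR]
    apply integral_mono_of_nonneg
    · exact Filter.Eventually.of_forall fun x => by positivity
    · exact (hGi.add (hSi.const_mul δ)).comp_sub_right y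
    · refine Filter.Eventually.of_forall fun x => ?_
      simp only [hder, Complex.norm_real, Real.norm_eq_abs, sq_abs, hG]
      refine add_le_add le_rfl ?_
      rcases le_or_gt ‖x‖ M with hx | hx
      · simp [hfar x hx]
      · have : a / ‖x‖ ^ 2 ≤ a / M ^ 2 := by gcongr
        gcongr
        exact this.trans hMδ

/-- Truncations of a decaying profile approximate its gradient energy and its `L^p` norm. -/
lemma exists_truncation_tendsto {d : ℕ} (hd : 3 ≤ d) {c p s : ℝ} (hc : 0 < c)
    (hs : s = ((d : ℝ) - 2) / 2) (hp : p = 2 * (d : ℝ) / ((d : ℝ) - 2)) :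
    let W : EuclideanSpace ℝ (Fin d) → ℝ := fun x => c * (1 + ‖x‖ ^ 2) ^ (-s)
    Integrable (fun x => W x ^ p) ∧
    ∃ g : ℕ → EuclideanSpace ℝ (Fin d) → ℝ,
      (∀ n, ContDiff ℝ (⊤ : ℕ∞) (g n)) ∧ (∀ n, g n ≠ 0) ∧
      (∀ (n : ℕ) x, 2 * ((n : ℝ) + 1) ≤ ‖x‖ → g n x = 0) ∧
      Filter.Tendsto (fun n => ∫ x, |g n x| ^ p) Filter.atTop (nhds (∫ x, W x ^ p)) ∧
      Filter.Tendsto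
        (fun n => ∫ x, ∑ i, (fderiv ℝ (g n) x (EuclideanSpace.single i 1)) ^ 2) Filter.atTop
        (nhds (∫ x, ∑ i, (fderiv ℝ W x (EuclideanSpace.single i 1)) ^ 2)) := by
  intro W
  have hd' : (3 : ℝ) ≤ d := by exact_mod_cast hd
  have hp0 : 0 < p := hp ▸ div_pos (by linarith) (by linarith)
  have hpos : ∀ x : EuclideanSpace ℝ (Fin d), (0 : ℝ) < 1 + ‖x‖ ^ 2 := fun x => by positivity
  have hWpos : ∀ x, 0 < W x := fun x => mul_pos hc (Real.rpow_pos_of_pos (hpos x) _)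
  have hW : ContDiff ℝ (⊤ : ℕ∞) W :=
    contDiff_const.mul ((contDiff_const.add (contDiff_norm_sq ℝ)).rpow_const_of_ne
      fun x => (hpos x).ne')
  have hWi : Integrable (fun x => W x ^ p) := by
    have h := (integrable_rpow_neg_one_add_norm_sq (E := EuclideanSpace ℝ (Fin d))
      (μ := volume) (r := 2 * d) (by simp; linarith)).const_mul (c ^ p)
    refine h.congr (Filter.Eventually.of_forall fun x => ?_)
    simp only [W]
    rw [Real.mul_rpow hc.le (Real.rpow_nonneg (hpos x).le _), ← Real.rpow_mul (hpos x).le]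
    congr 2
    rw [hs, hp]
    have : (d : ℝ) - 2 ≠ 0 := by linarith
    field_simp
  obtain ⟨χ, K, hK, hχ, hχ0, hχ1, hχin, hχout, hχd⟩ :=
    exists_cutoff_seq (EuclideanSpace ℝ (Fin d))
  have hg : ∀ n, ContDiff ℝ (⊤ : ℕ∞) (fun x => χ n x * W x) := fun n => (hχ n).mul hW
  have hnear : ∀ x, ∀ᶠ n in Filter.atTop, (fun x => χ n x * W x) =ᶠ[nhds x] W := fun x => by
    obtain ⟨N, hN⟩ := exists_nat_gt ‖x‖
    filter_upwards [Filter.eventually_ge_atTop N] with n hn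
    have hx : ‖x‖ < (n : ℝ) + 1 := by
      have : (N : ℝ) ≤ n := by exact_mod_cast hn
      linarith
    filter_upwards [(isOpen_lt continuous_norm continuous_const).mem_nhds hx] with z hz
    rw [hχin n z hz, one_mul]
  refine ⟨hWi, fun n x => χ n x * W x, hg, fun n h => ?_, fun n x hx => ?_, ?_, ?_⟩
  · have h0 := congrFun h 0
    simp only [Pi.zero_apply] at h0
    rw [hχin n 0 (by rw [norm_zero]; positivity), one_mul] at h0
    exact (hWpos 0).ne' h0
  · simp only [hχout n x hx, zero_mul]
  · refine tendsto_integral_of_dominated_convergence (fun x => W x ^ p)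
      (fun n => ((hg n).continuous.abs.rpow_const fun _ => Or.inr hp0.le).aestronglyMeasurable)
      hWi (fun n => Filter.Eventually.of_forall fun x => ?_)
      (Filter.Eventually.of_forall fun x => ?_)
    · rw [Real.norm_of_nonneg (Real.rpow_nonneg (abs_nonneg _) _),
        abs_of_nonneg (mul_nonneg (hχ0 n x) (hWpos x).le)]
      exact Real.rpow_le_rpow (mul_nonneg (hχ0 n x) (hWpos x).le)
        (mul_le_of_le_one_left (hWpos x).le (hχ1 n x)) hp0.le
    · refine tendsto_const_nhds.congr' ?_
      filter_upwards [hnear x] with n hn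
      rw [hn.eq_of_nhds, abs_of_pos (hWpos x)]
  · have hbound : ∀ n x, ‖fderiv ℝ (fun x => χ n x * W x) x‖ ≤
        (2 * |c| * |s| + c * K) * (1 + ‖x‖ ^ 2) ^ (-s - 1 / 2) := fun n x => by
      rw [fderiv_fun_mul ((hχ n).differentiable (by simp) x) (hW.differentiable (by simp) x)]
      have h1 := norm_fderiv_one_add_norm_sq_rpow_le c s x
      have h2 := hχd n x
      calc _ ≤ ‖χ n x • fderiv ℝ W x‖ + ‖W x • fderiv ℝ (χ n) x‖ := norm_add_le _ _
        _ ≤ 1 * (2 * |c| * |s| * (1 + ‖x‖ ^ 2) ^ (-s - 1 / 2)) +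
            W x * (K * (1 + ‖x‖ ^ 2) ^ (-(1 / 2) : ℝ)) := by
          rw [norm_smul, norm_smul, Real.norm_of_nonneg (hχ0 n x),
            Real.norm_of_nonneg (hWpos x).le]
          gcongr
          exact hχ1 n x
        _ = _ := by
          rw [sub_eq_add_neg (-s), Real.rpow_add (hpos x)]
          simp only [W]
          ring
    have hBi := (integrable_rpow_neg_one_add_norm_sq (E := EuclideanSpace ℝ (Fin d))
      (μ := volume) (r := 2 * (d - 1)) (by simp; linarith)).const_mul
        (d * (2 * |c| * |s| + c * K) ^ 2)
    refine tendsto_integral_of_dominated_convergence _ (fun n => ?_) hBi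
      (fun n => Filter.Eventually.of_forall fun x => ?_)
      (Filter.Eventually.of_forall fun x => ?_)
    · exact (continuous_finsetSum _ fun i _ =>
        (((hg n).continuous_fderiv (by simp)).clm_apply
          continuous_const).pow 2).aestronglyMeasurable
    · rw [Real.norm_of_nonneg (by positivity)]
      refine (sum_sq_apply_single_le _).trans ?_
      have he : (1 + ‖x‖ ^ 2) ^ (-(2 * ((d : ℝ) - 1)) / 2) =
          ((1 + ‖x‖ ^ 2) ^ (-s - 1 / 2)) ^ 2 := by
        rw [← Real.rpow_mul_natCast (hpos x).le, hs]
        congr 1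
        push_cast
        ring
      rw [he, mul_assoc, ← mul_pow]
      gcongr
      exact hbound n x
    · refine tendsto_const_nhds.congr' ?_
      filter_upwards [hnear x] with n hn
      rw [hn.fderiv_eq]

/-- For `a > 0`, the sharp classical Sobolev constant `C₀` cannot
be improved in the Sobolev inequality with inverse-square potential: for every
`ε > 0` there is a nonzero smooth compactly supported `f`, supported away from
the origin, with `‖f‖_{L^{2d/(d-2)}} > (C₀ - ε) · Q_a(f)^{1/2}`. -/
theorem sobolev_constant_sharp_positive_coupling
    (d : ℕ) (hd : 3 ≤ d) (a : ℝ) (ha : 0 < a)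
    (W₀ : EuclideanSpace ℝ (Fin d) → ℝ)
    (hW₀ : ∀ x, W₀ x = ((d : ℝ) * ((d : ℝ) - 2)) ^ (((d : ℝ) - 2) / 4) *
        (1 + ‖x‖ ^ 2) ^ (-(((d : ℝ) - 2) / 2)))
    (C₀ : ℝ)
    (hC₀ : C₀ = (∫ x : EuclideanSpace ℝ (Fin d),
          W₀ x ^ (2 * (d : ℝ) / ((d : ℝ) - 2))) ^ (((d : ℝ) - 2) / (2 * (d : ℝ)))
        * (Real.sqrt (∫ x : EuclideanSpace ℝ (Fin d),
            ∑ i, (fderiv ℝ W₀ x (EuclideanSpace.single i 1)) ^ 2))⁻¹) :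
    ∀ ε : ℝ, 0 < ε →
      ∃ f : EuclideanSpace ℝ (Fin d) → ℂ,
        ContDiff ℝ (⊤ : ℕ∞) f ∧ HasCompactSupport f ∧
        (0 : EuclideanSpace ℝ (Fin d)) ∉ tsupport f ∧ f ≠ 0 ∧
        (∫ x : EuclideanSpace ℝ (Fin d), ‖f x‖ ^ (2 * (d : ℝ) / ((d : ℝ) - 2)))
            ^ (((d : ℝ) - 2) / (2 * (d : ℝ)))
          > (C₀ - ε) * Real.sqrt (∫ x : EuclideanSpace ℝ (Fin d),
              ((∑ i, ‖fderiv ℝ f x (EuclideanSpace.single i 1)‖ ^ 2)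
                + a / ‖x‖ ^ 2 * ‖f x‖ ^ 2)) := by
  intro ε hε
  have hd' : (3 : ℝ) ≤ d := by exact_mod_cast hd
  have : Nonempty (Fin d) := ⟨⟨0, by omega⟩⟩
  have hc : 0 < ((d : ℝ) * ((d : ℝ) - 2)) ^ (((d : ℝ) - 2) / 4) :=
    Real.rpow_pos_of_pos (mul_pos (by linarith) (by linarith)) _
  obtain rfl : W₀ = fun x => ((d : ℝ) * ((d : ℝ) - 2)) ^ (((d : ℝ) - 2) / 4) *
        (1 + ‖x‖ ^ 2) ^ (-(((d : ℝ) - 2) / 2)) := funext hW₀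
  obtain ⟨hWi, g, hg, hg0, hgr, hA, hB⟩ := exists_truncation_tendsto hd hc rfl rfl
  set W₀ : EuclideanSpace ℝ (Fin d) → ℝ :=
    fun x => ((d : ℝ) * ((d : ℝ) - 2)) ^ (((d : ℝ) - 2) / 4) *
        (1 + ‖x‖ ^ 2) ^ (-(((d : ℝ) - 2) / 2))
  set A := ∫ x, W₀ x ^ (2 * (d : ℝ) / ((d : ℝ) - 2)) with hAdef
  set B := ∫ x, ∑ i, (fderiv ℝ W₀ x (EuclideanSpace.single i 1)) ^ 2
  have hWpos : ∀ x, 0 < W₀ x := fun x => mul_pos hc (Real.rpow_pos_of_pos (by positivity) _)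
  have hApos : 0 < A := by
    rw [hAdef, integral_pos_iff_support_of_nonneg
      (fun x => Real.rpow_nonneg (hWpos x).le _) hWi]
    have : Function.support (fun x => W₀ x ^ (2 * (d : ℝ) / ((d : ℝ) - 2))) = Set.univ :=
      Set.eq_univ_of_forall fun x => (Real.rpow_pos_of_pos (hWpos x) _).ne'
    rw [this]
    exact Measure.measure_univ_pos.2 (NeZero.ne _)
  have hAq : 0 < A ^ (((d : ℝ) - 2) / (2 * (d : ℝ))) := Real.rpow_pos_of_pos hApos _
  have hlim : max (C₀ - ε) 0 * Real.sqrt B < A ^ (((d : ℝ) - 2) / (2 * (d : ℝ))) := by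
    rcases (Real.sqrt_nonneg B).eq_or_lt with h | h
    · rwa [← h, mul_zero]
    · rw [max_mul_of_nonneg _ _ h.le, zero_mul]
      refine max_lt ?_ hAq
      rw [hC₀, sub_mul, mul_assoc, inv_mul_cancel₀ h.ne', mul_one]
      linarith [mul_pos hε h]
  obtain ⟨n, hn⟩ := ((tendsto_const_nhds.mul
    ((Real.continuous_sqrt.tendsto _).comp hB)).eventually_lt
      (hA.rpow_const (Or.inl hApos.ne')) hlim).exists
  obtain ⟨f, hf, hfc, hf0, hfne, hlt⟩ :=
    exists_translate_of_lt ha (le_max_right (C₀ - ε) 0) (hg n) (hg0 n) (hgr n) hn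
  exact ⟨f, hf, hfc, hf0, hfne, lt_of_le_of_lt
    (mul_le_mul_of_nonneg_right (le_max_left _ _) (Real.sqrt_nonneg _)) hlt⟩
end
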